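/- Let T be a tree on n vertices with l ≥ 3 leaves. Then tr(T) ≥ ⌈4(n−1)/(l−1)⌉. -/

import Mathlib

open Finset

/-- The triameter of a graph: the maximum of `d(u,v) + d(v,w) + d(u,w)` over all
triples of vertices. -/
noncomputable def SimpleGraph.triameter {V : Type*} [Fintype V] (G : SimpleGraph V) : ℕ :=
  Finset.univ.sup fun p : V × V × V =>
    G.dist p.1 p.2.1 + G.dist p.2.1 p.2.2 + G.dist p.1 p.2.2

/-- The number of leaves (vertices of degree 1) of a graph. -/
def SimpleGraph.numLeaves {V : Type*} [Fintype V] [DecidableEq V] (G : SimpleGraph V)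
    [DecidableRel G.Adj] : ℕ :=
  (Finset.univ.filter fun v => G.degree v = 1).card

namespace SimpleGraph

variable {V : Type*} {G : SimpleGraph V}

theorem Connected.exists_adj_dist_add_one_eq (hG : G.Connected) {a x : V} (h : x ≠ a) :
    ∃ p, G.Adj x p ∧ G.dist a p + 1 = G.dist a x := by
  obtain ⟨w, hw⟩ := hG.exists_walk_length_eq_dist x a
  cases w with
  | nil => exact absurd rfl h
  | @cons _ p _ hadj q =>
    refine ⟨p, hadj, ?_⟩
    have hq := dist_le q
    have htri := hG.dist_triangle (u := x) (v := p) (w := a)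
    have hxp := dist_eq_one_iff_adj.mpr hadj
    rw [Walk.length_cons] at hw
    rw [dist_comm (u := a) (v := p), dist_comm (u := a) (v := x)]
    lia

theorem dist_add_dist_add_dist_le_triameter [Fintype V] (G : SimpleGraph V) (u v w : V) :
    G.dist u v + G.dist v w + G.dist u w ≤ G.triameter :=
  Finset.le_sup (f := fun p : V × V × V ↦
    G.dist p.1 p.2.1 + G.dist p.2.1 p.2.2 + G.dist p.1 p.2.2) (mem_univ (u, v, w))

namespace IsTree

theorem eq_of_adj_of_dist_add_one_eq (hG : G.IsTree) {a x p q : V} (hp : G.Adj x p)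
    (hq : G.Adj x q) (hdp : G.dist a p + 1 = G.dist a x) (hdq : G.dist a q + 1 = G.dist a x) :
    p = q := by
  obtain ⟨w₁, hw₁⟩ := hG.connected.exists_walk_length_eq_dist p a
  obtain ⟨w₂, hw₂⟩ := hG.connected.exists_walk_length_eq_dist q a
  have h₁ := (Walk.cons hp w₁).isPath_of_length_eq_dist (by
    rw [Walk.length_cons, hw₁, dist_comm, hdp, dist_comm])
  have h₂ := (Walk.cons hq w₂).isPath_of_length_eq_dist (by
    rw [Walk.length_cons, hw₂, dist_comm, hdq, dist_comm])
  have h := congrArg Subtype.val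
    ((hG.isAcyclic.subsingleton_path x a).elim ⟨_, h₁⟩ ⟨_, h₂⟩)
  simpa using congrArg Walk.snd h

/-- Geodesics leaving `x` towards `a` and `b` through different neighbours concatenate. -/
theorem dist_eq_add_of_adj_of_ne (hG : G.IsTree) {a b x p q : V} (hp : G.Adj x p)
    (hq : G.Adj x q) (hdp : G.dist a p + 1 = G.dist a x) (hdq : G.dist b q + 1 = G.dist b x)
    (hne : p ≠ q) : G.dist a b = G.dist a x + G.dist b x := by
  induction hk : G.dist b q generalizing x p q with
  | zero =>
    obtain rfl : b = q := hG.connected.dist_eq_zero_iff.mp hk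
    rcases hG.dist_eq_dist_add_one_of_adj a hq with h | h
    · exact absurd (hG.eq_of_adj_of_dist_add_one_eq hp hq hdp h.symm) hne
    · lia
  | succ k ih =>
    rcases hG.dist_eq_dist_add_one_of_adj a hq with h | h
    · exact absurd (hG.eq_of_adj_of_dist_add_one_eq hp hq hdp h.symm) hne
    · have hqb : q ≠ b := by
        rintro rfl
        simp at hk
      obtain ⟨r, hr, hdr⟩ := hG.connected.exists_adj_dist_add_one_eq hqb
      have := ih hq.symm hr h.symm hdr (by rintro rfl; lia) (by lia)
      lia

theorem eq_of_dist_eq_of_dist_add_eq (hG : G.IsTree) {a v x y : V}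
    (hx : G.dist a x + G.dist v x = G.dist a v) (hy : G.dist a y + G.dist v y = G.dist a v)
    (h : G.dist v x = G.dist v y) : x = y := by
  induction hk : G.dist v x generalizing v with
  | zero =>
    exact (hG.connected.dist_eq_zero_iff.mp hk).symm.trans
      (hG.connected.dist_eq_zero_iff.mp (h.symm.trans hk))
  | succ k ih =>
    have hvx : v ≠ x := by rintro rfl; simp at hk
    have hvy : v ≠ y := by rintro rfl; rw [dist_self] at h; lia
    obtain ⟨p, hp, hdp⟩ := hG.connected.exists_adj_dist_add_one_eq hvx
    obtain ⟨q, hq, hdq⟩ := hG.connected.exists_adj_dist_add_one_eq hvy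
    rw [dist_comm (u := x) (v := p), dist_comm (u := x) (v := v)] at hdp
    rw [dist_comm (u := y) (v := q), dist_comm (u := y) (v := v)] at hdq
    have tp := hG.connected.dist_triangle (u := a) (v := x) (w := p)
    have tq := hG.connected.dist_triangle (u := a) (v := y) (w := q)
    rw [dist_comm (u := x) (v := p)] at tp
    rw [dist_comm (u := y) (v := q)] at tq
    have hp' : G.dist a p + 1 = G.dist a v := by
      rcases hG.dist_eq_dist_add_one_of_adj a hp with h | h <;> lia
    have hq' : G.dist a q + 1 = G.dist a v := by
      rcases hG.dist_eq_dist_add_one_of_adj a hq with h | h <;> lia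
    obtain rfl := hG.eq_of_adj_of_dist_add_one_eq hp hq hp' hq'
    exact ih (v := p) (by lia) (by lia) (by lia) (by lia)

theorem dist_add_dist_mod_two (hG : G.IsTree) (a x b : V) :
    (G.dist a x + G.dist b x) % 2 = G.dist a b % 2 := by
  induction hk : G.dist b x generalizing x with
  | zero => rw [hG.connected.dist_eq_zero_iff.mp hk, add_zero]
  | succ k ih =>
    have hxb : x ≠ b := by rintro rfl; simp at hk
    obtain ⟨p, hp, hdp⟩ := hG.connected.exists_adj_dist_add_one_eq hxb
    have := ih p (by lia)
    rcases hG.dist_eq_dist_add_one_of_adj a hp with h | h <;> lia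

variable [Fintype V]

theorem exists_adj_ne_of_degree_ne_one [DecidableRel G.Adj] [Nontrivial V] (hG : G.IsTree) {v : V}
    (hv : G.degree v ≠ 1) (p : V) : ∃ w, G.Adj v w ∧ w ≠ p := by
  have hpos := hG.connected.preconnected.degree_pos_of_nontrivial v
  rw [← card_neighborFinset_eq_degree] at hv hpos
  obtain ⟨w, hw, hne⟩ := Finset.exists_mem_ne (by lia : 1 < #(G.neighborFinset v)) p
  exact ⟨w, by simpa using hw, hne⟩

theorem degree_eq_one_of_forall_dist_le [DecidableRel G.Adj] [Nontrivial V] (hG : G.IsTree)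
    {a b : V} (hab : b ≠ a)
    (h : ∀ w, G.dist a w ≤ G.dist a b) : G.degree b = 1 := by
  by_contra hb
  obtain ⟨p, hp, hdp⟩ := hG.connected.exists_adj_dist_add_one_eq hab
  obtain ⟨w, hw, hne⟩ := hG.exists_adj_ne_of_degree_ne_one hb p
  have := h w
  rcases hG.dist_eq_dist_add_one_of_adj a hw with h' | h'
  · exact hne (hG.eq_of_adj_of_dist_add_one_eq hw hp h'.symm hdp)
  · lia

/-- A vertex off the geodesic from `a` to `b` lies on the geodesics from `a` and `b` to a
common leaf. -/
theorem exists_leaf_of_dist_ne [DecidableRel G.Adj] [Nontrivial V] (hG : G.IsTree) {a b x : V}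
    (hx : G.dist a x + G.dist b x ≠ G.dist a b) :
    ∃ v, G.degree v = 1 ∧ v ≠ a ∧ v ≠ b ∧ G.dist a x + G.dist v x = G.dist a v ∧
      G.dist b x + G.dist v x = G.dist b v := by
  have htri := hG.connected.dist_triangle (u := a) (v := x) (w := b)
  rw [dist_comm (u := x) (v := b)] at htri
  obtain ⟨v, hv, hmax⟩ := Finset.exists_max_image
    {v | G.dist a x + G.dist v x = G.dist a v ∧ G.dist b x + G.dist v x = G.dist b v}
    (G.dist a) ⟨x, by simp⟩
  simp only [mem_filter, mem_univ, true_and] at hv hmax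
  obtain ⟨hav, hbv⟩ := hv
  have hva : v ≠ a := by
    rintro rfl
    simp only [dist_self] at hav
    rw [dist_comm (u := b) (v := v)] at hbv
    lia
  have hvb : v ≠ b := by
    rintro rfl
    simp only [dist_self] at hbv
    lia
  refine ⟨v, ?_, hva, hvb, hav, hbv⟩
  by_contra hdeg
  obtain ⟨p, hp, hdp⟩ := hG.connected.exists_adj_dist_add_one_eq hva
  obtain ⟨q, hq, hdq⟩ := hG.connected.exists_adj_dist_add_one_eq hvb
  by_cases hpq : p = q
  · subst hpq
    obtain ⟨w, hw, hne⟩ := hG.exists_adj_ne_of_degree_ne_one hdeg p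
    have haw : G.dist a w = G.dist a v + 1 :=
      (hG.dist_eq_dist_add_one_of_adj a hw).resolve_left fun h ↦
        hne (hG.eq_of_adj_of_dist_add_one_eq hw hp h.symm hdp)
    have hbw : G.dist b w = G.dist b v + 1 :=
      (hG.dist_eq_dist_add_one_of_adj b hw).resolve_left fun h ↦
        hne (hG.eq_of_adj_of_dist_add_one_eq hw hp h.symm hdq)
    have t₁ := hG.connected.dist_triangle (u := w) (v := v) (w := x)
    have t₂ := hG.connected.dist_triangle (u := a) (v := x) (w := w)
    rw [dist_eq_one_iff_adj.mpr hw.symm] at t₁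
    rw [dist_comm (u := x) (v := w)] at t₂
    have := hmax w ⟨by lia, by lia⟩
    lia
  · have := hG.dist_eq_add_of_adj_of_ne hp hq hdp hdq hpq
    lia

theorem card_geodesic_le (hG : G.IsTree) (a b : V) :
    #{x | G.dist a x + G.dist b x = G.dist a b} ≤ G.dist a b + 1 := by
  rw [← card_range (G.dist a b + 1)]
  refine card_le_card_of_injOn (G.dist b) (fun x hx ↦ ?_) fun x hx y hy h ↦ ?_
  · simp only [coe_filter, mem_univ, true_and, Set.mem_ofPred_eq] at hx
    simp only [coe_range, Set.mem_Iio]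
    lia
  · simp only [coe_filter, mem_univ, true_and, Set.mem_ofPred_eq] at hx hy
    exact hG.eq_of_dist_eq_of_dist_add_eq hx hy h

theorem two_mul_card_branch_le (hG : G.IsTree) (a b v : V) :
    2 * #{x | G.dist a x + G.dist b x ≠ G.dist a b ∧ G.dist a x + G.dist v x = G.dist a v ∧
      G.dist b x + G.dist v x = G.dist b v} + G.dist a b ≤ G.dist a v + G.dist b v := by
  have htri := hG.connected.dist_triangle (u := a) (v := v) (w := b)
  rw [dist_comm (u := v) (v := b)] at htri
  suffices #{x | G.dist a x + G.dist b x ≠ G.dist a b ∧ G.dist a x + G.dist v x = G.dist a v ∧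
      G.dist b x + G.dist v x = G.dist b v} ≤ (G.dist a v + G.dist b v - G.dist a b) / 2 by lia
  rw [← card_range ((G.dist a v + G.dist b v - G.dist a b) / 2)]
  refine card_le_card_of_injOn (G.dist v) (fun x hx ↦ ?_) fun x hx y hy h ↦ ?_
  · simp only [coe_filter, mem_univ, true_and, Set.mem_ofPred_eq] at hx
    simp only [coe_range, Set.mem_Iio]
    have := hG.dist_add_dist_mod_two a x b
    have htri' := hG.connected.dist_triangle (u := a) (v := x) (w := b)
    rw [dist_comm (u := x) (v := b)] at htri'
    lia
  · simp only [coe_filter, mem_univ, true_and, Set.mem_ofPred_eq] at hx hy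
    exact hG.eq_of_dist_eq_of_dist_add_eq hx.2.1 hy.2.1 h

/-- Averaging over triples containing a diametral pair. -/
theorem six_mul_card_le [DecidableEq V] [DecidableRel G.Adj] [Nontrivial V] (hG : G.IsTree)
    (hl : 3 ≤ G.numLeaves) :
    6 * Fintype.card V ≤ G.triameter * G.numLeaves + 6 := by
  obtain ⟨⟨a, b⟩, -, hmax⟩ := Finset.exists_max_image univ
    (fun p : V × V ↦ G.dist p.1 p.2) univ_nonempty
  replace hmax : ∀ u v, G.dist u v ≤ G.dist a b := fun u v ↦ hmax (u, v) (mem_univ _)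
  have hab : b ≠ a := by
    rintro rfl
    obtain ⟨u, v, huv⟩ := exists_pair_ne V
    have := hG.connected.pos_dist_of_ne huv
    have := hmax u v
    simp only [dist_self] at this
    lia
  have hb : G.degree b = 1 := hG.degree_eq_one_of_forall_dist_le hab (hmax a)
  have ha : G.degree a = 1 := hG.degree_eq_one_of_forall_dist_le hab.symm
    fun w ↦ (hmax b w).trans_eq dist_comm
  set L : Finset V := ((univ.filter fun v ↦ G.degree v = 1).erase a).erase b with hL
  have hLcard : #L + 2 = G.numLeaves := by
    rw [hL, card_erase_of_mem (by simp [hb, hab]), card_erase_of_mem (by simp [ha])]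
    change #{v | G.degree v = 1} - 1 - 1 + 2 = #{v | G.degree v = 1}
    change 3 ≤ #{v | G.degree v = 1} at hl
    lia
  let B : V → Finset V := fun v ↦ {x | G.dist a x + G.dist b x ≠ G.dist a b ∧
    G.dist a x + G.dist v x = G.dist a v ∧ G.dist b x + G.dist v x = G.dist b v}
  have hcover : (univ : Finset V) ⊆
      ({x | G.dist a x + G.dist b x = G.dist a b} : Finset V) ∪ L.biUnion B := by
    intro x _
    by_cases hx : G.dist a x + G.dist b x = G.dist a b
    · simp [hx]
    · obtain ⟨v, hv, hva, hvb, h₁, h₂⟩ := hG.exists_leaf_of_dist_ne hx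
      refine mem_union_right _ (mem_biUnion.mpr ⟨v, ?_, ?_⟩)
      · simp [hL, hv, hva, hvb]
      · simp [B, hx, h₁, h₂]
  have hcard : Fintype.card V ≤ (G.dist a b + 1) + ∑ v ∈ L, #(B v) :=
    (card_le_card hcover).trans <| (card_union_le _ _).trans <|
      Nat.add_le_add (hG.card_geodesic_le a b) card_biUnion_le
  have hsum : ∑ v ∈ L, (2 * #(B v) + 2 * G.dist a b) ≤ ∑ _v ∈ L, G.triameter := by
    refine sum_le_sum fun v _ ↦ ?_
    have h₁ : 2 * #(B v) + G.dist a b ≤ G.dist a v + G.dist b v :=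
      hG.two_mul_card_branch_le a b v
    have h₂ := G.dist_add_dist_add_dist_le_triameter a b v
    lia
  rw [sum_add_distrib, ← mul_sum, sum_const, sum_const, smul_eq_mul, smul_eq_mul] at hsum
  have htri : G.triameter ≤ 3 * G.dist a b := Finset.sup_le fun p _ ↦ by
    have h₁ := hmax p.1 p.2.1
    have h₂ := hmax p.2.1 p.2.2
    have h₃ := hmax p.1 p.2.2
    lia
  obtain ⟨k, hk⟩ : ∃ k, #L = k + 1 := ⟨#L - 1, by lia⟩
  rw [← hLcard]
  rw [hk] at hsum ⊢
  nlinarith [Nat.mul_le_mul_left k htri]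

end IsTree

end SimpleGraph

theorem tree_triameter_lower_bound {V : Type*} [Fintype V] [DecidableEq V]
    (T : SimpleGraph V) [DecidableRel T.Adj]
    (htree : T.IsTree) (hn : 3 ≤ Fintype.card V) (hl : 3 ≤ T.numLeaves) :
    ⌈(4 * ((Fintype.card V : ℚ) - 1)) / ((T.numLeaves : ℚ) - 1)⌉ ≤ (T.triameter : ℤ) := by
  have : Nontrivial V := Fintype.one_lt_card_iff_nontrivial.mp (by lia)
  have key : (6 * Fintype.card V : ℚ) ≤ T.triameter * T.numLeaves + 6 := by
    exact_mod_cast htree.six_mul_card_le hl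
  have hn' : (3 : ℚ) ≤ Fintype.card V := by exact_mod_cast hn
  have hl' : (3 : ℚ) ≤ T.numLeaves := by exact_mod_cast hl
  have ht : (0 : ℚ) ≤ T.triameter := Nat.cast_nonneg _
  rw [Int.ceil_le, div_le_iff₀ (by linarith), Int.cast_natCast]
  nlinarith [mul_nonneg ht (sub_nonneg.mpr hl')]
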